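/- arXiv:2506.03845 — 2 statements merged into one kernel-verified Lean document; each statement's English description precedes it below -/
import Mathlib

section
/- Let 𝒜 be a complex unital Banach algebra, let n ≥ 1 be an integer, and let a, b ∈ 𝒜 both be gns-Drazin invertible with a b = b a. Then: (i) if a b is quasinilpotent, then a + b is gns-Drazin invertible; (ii) if a + b is gns-Drazin invertible, then a b · (∑_{k=1}^{n} C(n+1, k) a^{k−1} b^{n−k}) is quasinilpotent, where C(n+1,k) denotes the binomial coefficient. -/
variable {A : Type*} [NormedRing A] [NormedAlgebra ℂ A] [CompleteSpace A]

/-- An element of a complex unital Banach algebra is quasinilpotent if its spectrum is `{0}`. -/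
def IsQuasinilpotent (q : A) : Prop := spectrum ℂ q = {0}

/-- `a` is generalized `n`-strong Drazin invertible (gns-Drazin invertible): there is `x`
commuting with every element commuting with `a`, with `x * a * x = x` and
`a ^ n - a * x` quasinilpotent. -/
def IsGnsDrazinInvertible (n : ℕ) (a : A) : Prop :=
  ∃ x : A, (∀ y : A, y * a = a * y → x * y = y * x) ∧ x * a * x = x ∧
    IsQuasinilpotent (a ^ n - a * x)


def QN (q : A) : Prop := ∀ ε : ℝ, 0 < ε → ∃ C : ℝ, 0 < C ∧ ∀ k : ℕ, ‖q ^ k‖ ≤ C * ε ^ k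

theorem qn_of_isQ (q : A) (h : IsQuasinilpotent q) : QN q := by
  intro ε hε
  have h0 : spectralRadius ℂ q = 0 := by
    unfold IsQuasinilpotent at h
    simp [spectralRadius, h]
  have ht := spectrum.pow_norm_pow_one_div_tendsto_nhds_spectralRadius q
  rw [h0] at ht
  have hev := ht.eventually (gt_mem_nhds (ENNReal.ofReal_pos.2 hε))
  obtain ⟨N, hN⟩ := Filter.eventually_atTop.1 (hev.and (Filter.eventually_ge_atTop 1))
  have hpos : ∀ k, 0 ≤ ‖q ^ k‖ / ε ^ k := fun k => by positivity
  refine ⟨1 + ∑ k ∈ Finset.range N, ‖q ^ k‖ / ε ^ k, ?_, ?_⟩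
  · have := Finset.sum_nonneg (s := Finset.range N) (fun k _ => hpos k)
    linarith
  · intro k
    have hs := Finset.sum_nonneg (s := Finset.range N) (fun k _ => hpos k)
    have hek : 0 < ε ^ k := by positivity
    rw [← div_le_iff₀ hek]
    by_cases hk : k < N
    · have := Finset.single_le_sum (f := fun k => ‖q ^ k‖ / ε ^ k) (fun k _ => hpos k)
        (Finset.mem_range.2 hk)
      linarith
    · obtain ⟨h1, h2⟩ := hN k (not_lt.1 hk)
      have h3 := (ENNReal.ofReal_lt_ofReal_iff hε).1 h1
      have h4 : ‖q ^ k‖ ≤ ε ^ k := by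
        have h5 : (‖q ^ k‖ ^ (1 / k : ℝ)) ^ k = ‖q ^ k‖ := by
          rw [one_div]
          exact Real.rpow_inv_natCast_pow (norm_nonneg _) (by omega)
        rw [← h5]
        gcongr
      have : ‖q ^ k‖ / ε ^ k ≤ 1 := by
        rw [div_le_iff₀ hek]; linarith
      linarith

/-- geometric decay beats constants -/
theorem zero_of_geom {E : Type*} [NormedRing E] (d : E) (C : ℝ)
    (h : ∀ k : ℕ, ‖d‖ ≤ C * (1 / 2) ^ k) : d = 0 := by
  have ht : Filter.Tendsto (fun k : ℕ => C * (1 / 2 : ℝ) ^ k) Filter.atTop (nhds (C * 0)) :=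
    (tendsto_pow_atTop_nhds_zero_of_lt_one (by norm_num) (by norm_num)).const_mul C
  have := ge_of_tendsto' ht h
  rw [mul_zero] at this
  exact norm_le_zero_iff.1 this

theorem isQ_of_qn [Nontrivial A] (q : A) (h : QN q) : IsQuasinilpotent q := by
  unfold IsQuasinilpotent
  refine (spectrum.nonempty q).subset_singleton_iff.1 ?_
  intro l hl
  rw [Set.mem_singleton_iff]
  by_contra hne
  have hp : 0 < ‖l‖ := norm_pos_iff.2 hne
  obtain ⟨C, hC, hk⟩ := h (‖l‖ / 2) (by positivity)
  have : (1 : ℝ) = 0 := by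
    apply zero_of_geom _ (C * ‖(1 : A)‖)
    intro k
    have h1 := spectrum.norm_le_norm_mul_of_mem (spectrum.pow_mem_pow q k hl)
    have h2 := hk k
    have h3 : ‖l‖ ^ k ≤ (C * (‖l‖ / 2) ^ k) * ‖(1 : A)‖ := by
      rw [← norm_pow]
      exact h1.trans (by gcongr)
    have h4 : 0 < ‖l‖ ^ k := by positivity
    have h5 : (‖l‖ / 2) ^ k = ‖l‖ ^ k * (1 / 2) ^ k := by
      rw [← mul_pow]; ring
    rw [h5] at h3
    rw [norm_one]
    refine le_of_mul_le_mul_left ?_ h4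
    linarith
  norm_num at this

theorem QN.add {p q : A} (hp : QN p) (hq : QN q) (h : Commute p q) : QN (p + q) := by
  intro ε hε
  obtain ⟨C, hC, hk⟩ := hp (ε / 2) (by positivity)
  obtain ⟨D, hD, hl⟩ := hq (ε / 2) (by positivity)
  refine ⟨C * D * (‖(1 : A)‖ + 1), by positivity, fun k => ?_⟩
  rw [h.add_pow']
  have h1 : ∀ m ∈ Finset.HasAntidiagonal.antidiagonal k,
      ‖k.choose m.1 • (p ^ m.1 * q ^ m.2)‖ ≤ k.choose m.1 * (C * D * (ε / 2) ^ k) := by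
    intro m hm
    rw [Finset.HasAntidiagonal.mem_antidiagonal] at hm
    refine (norm_nsmul_le).trans ?_
    gcongr
    calc ‖p ^ m.1 * q ^ m.2‖ ≤ ‖p ^ m.1‖ * ‖q ^ m.2‖ := norm_mul_le _ _
      _ ≤ (C * (ε / 2) ^ m.1) * (D * (ε / 2) ^ m.2) := by
        gcongr
        · exact hk _
        · exact hl _
      _ = _ := by rw [← hm, pow_add]; ring
  refine (norm_sum_le_of_le _ h1).trans ?_
  rw [← Finset.sum_mul]
  have h2 : ∑ i ∈ Finset.HasAntidiagonal.antidiagonal k, (k.choose i.1 : ℝ) = 2 ^ k := by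
    rw [Finset.Nat.sum_antidiagonal_eq_sum_range_succ_mk]
    exact_mod_cast Nat.sum_range_choose k
  rw [h2]
  have h3 : (2 : ℝ) ^ k * (C * D * (ε / 2) ^ k) = C * D * ε ^ k := by
    rw [div_pow]; field_simp
  rw [h3]
  have : 0 ≤ C * D * ε ^ k * ‖(1 : A)‖ := by positivity
  linarith

theorem QN.mul {p r : A} (hp : QN p) (h : Commute p r) : QN (p * r) := by
  intro ε hε
  obtain ⟨C, hC, hk⟩ := hp (ε / (‖r‖ + 1)) (by positivity)
  refine ⟨C * (‖(1 : A)‖ + 1), by positivity, fun k => ?_⟩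
  rw [h.mul_pow]
  have hr : ‖r ^ k‖ ≤ (‖(1 : A)‖ + 1) * (‖r‖ + 1) ^ k := by
    rcases Nat.eq_zero_or_pos k with rfl | hk0
    · simp
    · calc ‖r ^ k‖ ≤ ‖r‖ ^ k := norm_pow_le' r hk0
        _ ≤ (‖r‖ + 1) ^ k := by gcongr; linarith
        _ ≤ _ := by
          have : 0 ≤ ‖(1 : A)‖ * (‖r‖ + 1) ^ k := by positivity
          linarith
  calc ‖p ^ k * r ^ k‖ ≤ ‖p ^ k‖ * ‖r ^ k‖ := norm_mul_le _ _
    _ ≤ (C * (ε / (‖r‖ + 1)) ^ k) * ((‖(1 : A)‖ + 1) * (‖r‖ + 1) ^ k) := by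
      gcongr
      exact hk k
    _ = _ := by
      rw [div_pow]; field_simp

theorem QN.neg {p : A} (hp : QN p) : QN (-p) := by
  have := hp.mul (r := -1) (by simp)
  simpa using this

theorem QN.sub {p q : A} (hp : QN p) (hq : QN q) (h : Commute p q) : QN (p - q) := by
  rw [sub_eq_add_neg]
  exact hp.add hq.neg h.neg_right

theorem QN.of_pow [Nontrivial A] {p : A} {n : ℕ} (hp : QN (p ^ n)) : QN p := by
  apply qn_of_isQ
  have h := isQ_of_qn _ hp
  unfold IsQuasinilpotent at *
  refine (spectrum.nonempty p).subset_singleton_iff.1 ?_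
  intro l hl
  have := spectrum.pow_mem_pow p n hl
  rw [h] at this
  exact eq_zero_of_pow_eq_zero (n := n) this

theorem QN.isUnit [Nontrivial A] {p : A} (hp : QN p) : IsUnit (1 + p) := by
  have h := isQ_of_qn _ hp.neg
  unfold IsQuasinilpotent at h
  have h1 : (1 : ℂ) ∉ spectrum ℂ (-p) := by rw [h]; simp
  rw [spectrum.notMem_iff] at h1
  simpa using h1

theorem bound_zero {d v w : A} (hw : QN w) (h : ∀ k : ℕ, ‖d‖ ≤ ‖v ^ k‖ * ‖d‖ * ‖w ^ k‖) :
    d = 0 := by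
  obtain ⟨C, hC, hk⟩ := hw (1 / (2 * (‖v‖ + 1))) (by positivity)
  apply zero_of_geom d ((‖(1 : A)‖ + 1) * ‖d‖ * C)
  intro k
  have hr : ‖v ^ k‖ ≤ (‖(1 : A)‖ + 1) * (‖v‖ + 1) ^ k := by
    rcases Nat.eq_zero_or_pos k with rfl | hk0
    · simp
    · calc ‖v ^ k‖ ≤ ‖v‖ ^ k := norm_pow_le' v hk0
        _ ≤ (‖v‖ + 1) ^ k := by gcongr; linarith
        _ ≤ _ := by
          have : 0 ≤ ‖(1 : A)‖ * (‖v‖ + 1) ^ k := by positivity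
          linarith
  calc ‖d‖ ≤ ‖v ^ k‖ * ‖d‖ * ‖w ^ k‖ := h k
    _ ≤ ((‖(1 : A)‖ + 1) * (‖v‖ + 1) ^ k) * ‖d‖ * (C * (1 / (2 * (‖v‖ + 1))) ^ k) := by
      gcongr
      exact hk k
    _ = _ := by
      rw [div_pow, div_pow, mul_pow]; field_simp

theorem left_zero {d v w : A} (hw : QN w) (h : d = v * d * w) : d = 0 := by
  have hk : ∀ k : ℕ, d = v ^ k * d * w ^ k := by
    intro k
    induction k with
    | zero => simp
    | succ k ih =>
      calc d = v ^ k * d * w ^ k := ih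
        _ = v ^ k * (v * d * w) * w ^ k := by rw [← h]
        _ = _ := by rw [pow_succ v, pow_succ' w]; simp only [mul_assoc]
  refine bound_zero (v := v) hw fun k => ?_
  calc ‖d‖ = ‖v ^ k * d * w ^ k‖ := by rw [← hk k]
    _ ≤ _ := (norm_mul_le _ _).trans (by gcongr; exact norm_mul_le _ _)

theorem right_zero {d v w : A} (hw : QN w) (h : d = w * d * v) : d = 0 := by
  have hk : ∀ k : ℕ, d = w ^ k * d * v ^ k := by
    intro k
    induction k with
    | zero => simp
    | succ k ih =>
      calc d = w ^ k * d * v ^ k := ih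
        _ = w ^ k * (w * d * v) * v ^ k := by rw [← h]
        _ = _ := by rw [pow_succ w, pow_succ' v]; simp only [mul_assoc]
  refine bound_zero (v := v) hw fun k => ?_
  calc ‖d‖ = ‖w ^ k * d * v ^ k‖ := by rw [← hk k]
    _ ≤ ‖w ^ k‖ * ‖d‖ * ‖v ^ k‖ := (norm_mul_le _ _).trans (by gcongr; exact norm_mul_le _ _)
    _ = _ := by ring

theorem idem_comm [Nontrivial A] {e w y : A} (he : e * e = e) (hew : Commute e w) (hw : QN w)
    (hy : Commute y (e + w)) : Commute e y := by
  obtain ⟨u, hu⟩ := hw.isUnit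
  have hu1 : (↑u⁻¹ : A) * (1 + w) = 1 := by rw [← hu]; simp
  have hu2 : (1 + w) * (↑u⁻¹ : A) = 1 := by rw [← hu]; simp
  have h1e : Commute (1 - e) (e + w) :=
    ((Commute.one_left _).sub_left ((Commute.refl e).add_right hew))
  have hee : Commute e (e + w) := (Commute.refl e).add_right hew
  have hd1 : e * y * (1 - e) = 0 := by
    apply left_zero (v := (↑u⁻¹ : A)) hw
    have hc : (e + w) * (e * y * (1 - e)) = (e * y * (1 - e)) * (e + w) :=
      ((hee.mul_left hy).mul_left h1e).symm.eq
    have h1 : (e + w) * (e * y * (1 - e)) = (1 + w) * (e * y * (1 - e)) := by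
      have : e * (e * y * (1 - e)) = e * y * (1 - e) := by
        rw [← mul_assoc, ← mul_assoc, he]
      rw [add_mul, add_mul, this, one_mul]
    have h2 : (e * y * (1 - e)) * (e + w) = (e * y * (1 - e)) * w := by
      have : (e * y * (1 - e)) * e = 0 := by
        rw [mul_assoc, sub_mul, he, one_mul, sub_self, mul_zero]
      rw [mul_add, this, zero_add]
    rw [mul_assoc (↑u⁻¹ : A), ← h2, ← hc, h1, ← mul_assoc, hu1, one_mul]
  have hd2 : (1 - e) * y * e = 0 := by
    apply right_zero (v := (↑u⁻¹ : A)) hw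
    have hc : (e + w) * ((1 - e) * y * e) = ((1 - e) * y * e) * (e + w) :=
      ((h1e.mul_left hy).mul_left hee).symm.eq
    have h1 : ((1 - e) * y * e) * (e + w) = ((1 - e) * y * e) * (1 + w) := by
      have : ((1 - e) * y * e) * e = (1 - e) * y * e := by
        rw [mul_assoc, he]
      rw [mul_add, mul_add, this, mul_one]
    have h2 : (e + w) * ((1 - e) * y * e) = w * ((1 - e) * y * e) := by
      have : e * ((1 - e) * y * e) = 0 := by
        rw [← mul_assoc, ← mul_assoc, mul_sub, he, mul_one, sub_self, zero_mul, zero_mul]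
      rw [add_mul, this, zero_add]
    rw [← h2, hc, h1, mul_assoc ((1 - e) * y * e), hu2, mul_one]
  have h1 : e * y = e * y * e := by
    rw [mul_sub, mul_one, sub_eq_zero] at hd1; exact hd1
  have h2 : y * e = e * y * e := by
    rw [sub_mul, sub_mul, one_mul, sub_eq_zero] at hd2; exact hd2
  exact h1.trans h2.symm

theorem add_pow_split (a b : A) (h : Commute a b) (n : ℕ) :
    (a + b) ^ (n + 1) = a ^ (n + 1) + b ^ (n + 1) +
      a * b * ∑ k ∈ Finset.Icc 1 n, ((n + 1).choose k : A) * (a ^ (k - 1) * b ^ (n - k)) := by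
  rw [h.add_pow, Finset.sum_range_succ, Finset.sum_range_succ', Finset.mul_sum,
    ← Finset.Ico_succ_right_eq_Icc, Finset.sum_Ico_eq_sum_range]
  have : ∀ k ∈ Finset.range n, a ^ (k + 1) * b ^ (n + 1 - (k + 1)) * ((n + 1).choose (k + 1) : A)
      = a * b * (((n + 1).choose (1 + k) : A) * (a ^ (1 + k - 1) * b ^ (n - (1 + k)))) := by
    intro k hk
    rw [Finset.mem_range] at hk
    obtain ⟨m, rfl⟩ : ∃ m, n = k + 1 + m := ⟨n - (k + 1), by omega⟩
    have e1 : k + 1 + m + 1 - (k + 1) = m + 1 := by omega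
    have e2 : 1 + k - 1 = k := by omega
    have e3 : k + 1 + m - (1 + k) = m := by omega
    rw [e1, e2, e3, add_comm 1 k, (Nat.cast_commute _ _).eq, ← mul_assoc, pow_succ' a,
      pow_succ' b]
    congr 1
    have := (h.pow_left k).eq
    calc a * a ^ k * (b * b ^ m) = a * (a ^ k * b) * b ^ m := by simp only [mul_assoc]
      _ = _ := by rw [this]; simp only [mul_assoc]
  rw [show Order.succ n - 1 = n from by simp, ← Finset.sum_congr rfl this]
  simp
  abel

theorem sum_commute (a b y : A) (h1 : Commute y a) (h2 : Commute y b) (n : ℕ) :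
    Commute y (∑ k ∈ Finset.Icc 1 n, ((n + 1).choose k : A) * (a ^ (k - 1) * b ^ (n - k))) :=
  Commute.sum_right _ _ _ fun k _ =>
    (Nat.commute_cast _ _).mul_right ((h1.pow_right _).mul_right (h2.pow_right _))

theorem qn_pow_succ_sub [Nontrivial A] {n : ℕ} (hn : 1 ≤ n) {a : A}
    (ha : IsGnsDrazinInvertible n a) : QN (a ^ (n + 1) - a) := by
  obtain ⟨x, hx, hxax, hq⟩ := ha
  have hq := qn_of_isQ _ hq
  have hxa : Commute x a := hx a rfl
  have hap : Commute a (a * x) := (Commute.refl a).mul_right hxa.symm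
  have hpp : (a * x) * (a * x) = a * x := by
    rw [mul_assoc, ← mul_assoc x, hxax]
  set p := a * x
  have hi : IsIdempotentElem (1 - p) := IsIdempotentElem.one_sub hpp
  have hc : Commute a (1 - p) := (Commute.one_right a).sub_right hap
  have haw : Commute (a ^ n - p) a := ((Commute.refl a).pow_left n).sub_left hap.symm
  have hpw : Commute (a ^ n - p) (1 - p) :=
    (hc.pow_left n).sub_left ((Commute.one_right p).sub_right (Commute.refl p))
  have h2 : QN (a * (1 - p)) := by
    apply QN.of_pow (n := n)
    have : (a * (1 - p)) ^ n = (a ^ n - p) * (1 - p) := by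
      rw [hc.mul_pow, hi.pow_eq (by omega), sub_mul, mul_sub p, hpp]
      simp
    rw [this]
    exact hq.mul hpw
  have h1 := hq.mul haw
  have : a ^ (n + 1) - a = (a ^ n - p) * a - a * (1 - p) := by
    rw [pow_succ, sub_mul, mul_sub, mul_one, hap.eq]; abel
  rw [this]
  exact h1.sub h2 ((haw.mul_left (Commute.refl a)).mul_right (hpw.mul_left hc))

theorem isGnsDrazinInvertible_add_of_comm (n : ℕ) (hn : 1 ≤ n) (a b : A)
    (ha : IsGnsDrazinInvertible n a) (hb : IsGnsDrazinInvertible n b)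
    (hab : a * b = b * a) :
    (IsQuasinilpotent (a * b) → IsGnsDrazinInvertible n (a + b)) ∧
    (IsGnsDrazinInvertible n (a + b) →
      IsQuasinilpotent
        (a * b * ∑ k ∈ Finset.Icc 1 n, ((n + 1).choose k : A) * (a ^ (k - 1) * b ^ (n - k)))) := by
  have hnt : Nontrivial A := by
    obtain ⟨x, -, -, h⟩ := ha
    by_contra hcon
    rw [not_nontrivial_iff_subsingleton] at hcon
    unfold IsQuasinilpotent at h
    rw [spectrum.of_subsingleton] at h
    exact Set.singleton_ne_empty _ h.symm
  have hab' : Commute a b := hab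
  constructor
  · intro hq
    have hq := qn_of_isQ _ hq
    obtain ⟨x, hx, hxax, hqa⟩ := ha
    obtain ⟨y, hy, hyby, hqb⟩ := hb
    have hqa := qn_of_isQ _ hqa
    have hqb := qn_of_isQ _ hqb
    have hxa : Commute x a := hx a rfl
    have hxb : Commute x b := hx b hab.symm
    have hyb : Commute y b := hy b rfl
    have hya : Commute y a := hy a hab
    have hyx : Commute y x := hy x hxb
    have hpp : (a * x) * (a * x) = a * x := by rw [mul_assoc, ← mul_assoc x, hxax]
    have hqq : (b * y) * (b * y) = b * y := by rw [mul_assoc, ← mul_assoc y, hyby]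
    have hap : Commute a (a * x) := (Commute.refl a).mul_right hxa.symm
    have hbp : Commute b (a * x) := hab'.symm.mul_right hxb.symm
    have hbq : Commute b (b * y) := (Commute.refl b).mul_right hyb.symm
    have haq : Commute a (b * y) := hab'.mul_right hya.symm
    have hpq : Commute (a * x) (b * y) :=
      haq.mul_left (hxb.mul_right hyx.symm)
    set p := a * x
    set q := b * y
    have hpq0 : p * q = 0 := by
      -- p q = (ab) (x y), idempotent and quasinilpotent
      have hQ : QN (p * q) := by
        have e : p * q = (a * b) * (x * y) := by
          show a * x * (b * y) = a * b * (x * y)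
          rw [mul_assoc, ← mul_assoc x, hxb.eq]; simp only [mul_assoc]
        rw [e]
        exact hq.mul ((hxa.symm.mul_right hya.symm).mul_left (hxb.symm.mul_right hyb.symm))
      have hid : (p * q) * (p * q) = p * q := by
        rw [mul_assoc, ← mul_assoc q, ← hpq.eq, mul_assoc p q q, hqq, ← mul_assoc, hpp]
      apply left_zero (v := 1) hQ
      rw [one_mul, hid]
    have hqp0 : q * p = 0 := by rw [← hpq.eq, hpq0]
    obtain ⟨m, rfl⟩ : ∃ m, n = m + 1 := ⟨n - 1, by omega⟩
    set e := p + q with he_def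
    set c := a + b with hc_def
    have hee : e * e = e := by
      rw [he_def, add_mul, mul_add, mul_add, hpp, hqq, hpq0, hqp0]; simp
    have hce : Commute c e := (hap.add_right haq).add_left (hbp.add_right hbq)
    have hw : QN (c ^ (m + 1) - e) := by
      have e1 := add_pow_split a b hab' m
      set S := ∑ k ∈ Finset.Icc 1 m, ((m + 1).choose k : A) * (a ^ (k - 1) * b ^ (m - k)) with hS
      have haS : Commute a S := sum_commute a b a (Commute.refl a) hab' m
      have hbS : Commute b S := sum_commute a b b hab'.symm (Commute.refl b) m
      have hpS : Commute p S := (sum_commute a b p hap.symm hbp.symm m)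
      have hqS : Commute q S := (sum_commute a b q haq.symm hbq.symm m)
      have e2 : c ^ (m + 1) - e = (a ^ (m + 1) - p) + (b ^ (m + 1) - q) + a * b * S := by
        rw [e1]; simp only [he_def]; abel
      rw [e2]
      have c1 : ∀ z, Commute a z → Commute p z → Commute (a ^ (m + 1) - p) z :=
        fun z h h' => (h.pow_left _).sub_left h'
      have c2 : ∀ z, Commute b z → Commute q z → Commute (b ^ (m + 1) - q) z :=
        fun z h h' => (h.pow_left _).sub_left h'
      have k1 : Commute (a ^ (m + 1) - p) (b ^ (m + 1) - q) :=
        c1 _ ((hab'.pow_right _).sub_right haq) ((hbp.symm.pow_right _).sub_right hpq)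
      have k2 : Commute (a ^ (m + 1) - p) (a * b * S) :=
        c1 _ (((Commute.refl a).mul_right hab').mul_right haS)
          ((hap.symm.mul_right hbp.symm).mul_right hpS)
      have k3 : Commute (b ^ (m + 1) - q) (a * b * S) :=
        c2 _ ((hab'.symm.mul_right (Commute.refl b)).mul_right hbS)
          ((haq.symm.mul_right hbq.symm).mul_right hqS)
      exact (hqa.add hqb k1).add (hq.mul (haS.mul_left hbS)) (k2.add_left k3)
    have hwe : Commute (c ^ (m + 1) - e) e := (hce.pow_left _).sub_left (Commute.refl e)
    clear_value e c
    have hu : IsUnit (c * e + (1 - e)) := by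
      have h1 : ∀ k : ℕ, (c * e + (1 - e)) ^ (k + 1) = c ^ (k + 1) * e + (1 - e) := by
        intro k
        induction k with
        | zero => simp
        | succ k ih =>
          rw [pow_succ, ih]
          have z1 : e * (1 - e) = 0 := by rw [mul_sub, hee, mul_one, sub_self]
          have z2 : (1 - e) * e = 0 := by rw [sub_mul, hee, one_mul, sub_self]
          have z3 : (1 - e) * (1 - e) = 1 - e := by rw [mul_sub, z2, mul_one, sub_zero]
          have z4 : c ^ (k + 1) * e * (c * e) = c ^ (k + 1 + 1) * e := by
            rw [hce.eq, ← mul_assoc, mul_assoc _ e e, hee, mul_assoc, ← hce.eq, ← mul_assoc,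
              ← pow_succ]
          rw [add_mul, mul_add, mul_add, z3, z4, hce.eq, ← mul_assoc (1 - e), z2,
            mul_assoc _ e (1 - e), z1]
          simp
      have h2 : IsUnit ((c * e + (1 - e)) ^ (m + 1)) := by
        have : (c * e + (1 - e)) ^ (m + 1) = 1 + (c ^ (m + 1) - e) * e := by
          rw [h1, sub_mul, hee]; abel
        rw [this]
        exact (hw.mul hwe).isUnit
      exact (isUnit_pow_iff (by omega)).1 h2
    obtain ⟨u, hu⟩ := hu
    have huinv : ∀ z : A, Commute z c → Commute z e → Commute z (↑u⁻¹ : A) := by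
      intro z hzc hze
      apply Commute.units_inv_right
      rw [hu]
      exact (hzc.mul_right hze).add_right ((Commute.one_right z).sub_right hze)
    have heu : Commute e (↑u⁻¹ : A) := huinv e hce.symm (Commute.refl e)
    have hcz : c * (e * (↑u⁻¹ : A)) = e := by
      have h1 : e * (u : A) = c * e := by
        rw [hu, mul_add, mul_sub, hee, mul_one, sub_self, add_zero, ← mul_assoc, ← hce.eq,
          mul_assoc, hee]
      rw [← mul_assoc, ← h1, mul_assoc, Units.mul_inv, mul_one]
    refine ⟨e * (↑u⁻¹ : A), ?_, ?_, ?_⟩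
    · intro z hz
      have hzc : Commute z c := hz
      have hez : Commute e z := by
        apply idem_comm hee hwe.symm hw
        have : e + (c ^ (m + 1) - e) = c ^ (m + 1) := by abel
        rw [this]
        exact hzc.pow_right _
      exact (hez.mul_left (huinv z hzc hez.symm).symm).eq
    · rw [mul_assoc, hcz, mul_assoc, ← heu.eq, ← mul_assoc, hee]
    · rw [hcz]
      exact isQ_of_qn _ hw
  · intro hs
    apply isQ_of_qn
    have h1 := qn_pow_succ_sub hn ha
    have h2 := qn_pow_succ_sub hn hb
    have h3 := qn_pow_succ_sub hn hs
    have e1 := add_pow_split a b hab' n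
    set S := ∑ k ∈ Finset.Icc 1 n, ((n + 1).choose k : A) * (a ^ (k - 1) * b ^ (n - k)) with hS
    have e2 : a * b * S = ((a + b) ^ (n + 1) - (a + b)) -
        ((a ^ (n + 1) - a) + (b ^ (n + 1) - b)) := by
      rw [e1]; abel
    rw [e2]
    have c0 : ∀ s t : A, Commute s t → Commute (s ^ (n + 1) - s) (t ^ (n + 1) - t) := by
      intro s t h
      exact ((h.pow_right _).sub_right h).pow_left _ |>.sub_left ((h.pow_right _).sub_right h)
    refine h3.sub (h1.add h2 (c0 _ _ hab')) ?_
    exact (c0 _ _ ((Commute.refl a).add_left hab'.symm)).add_right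
      (c0 _ _ (hab'.add_left (Commute.refl b)))
end

section
/- Let 𝒜 be a complex unital Banach algebra, let n ≥ 1 be an integer, and let a, b ∈ 𝒜 both be gns-Drazin invertible with gns-Drazin inverses x and y respectively; set a^π = 1 − a x and b^π = 1 − b y. If a = a b^π, b^π b a^π = b^π b, and b^π a^π b a = b^π a^π a b, then a + b is gns-Drazin invertible. -/
variable {A : Type*} [NormedRing A] [NormedAlgebra ℂ A] [CompleteSpace A]

set_option linter.unusedSimpArgs false
set_option linter.unusedSectionVars false

/-- Working form of quasinilpotency. -/
def Qn (q : A) : Prop := ∀ c : ℂ, IsUnit (1 - c • q)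

theorem qn_iff_spec (q : A) : Qn q ↔ spectrum ℂ q ⊆ {0} := by
  constructor
  · intro h z hz
    by_contra hne
    have hne : z ≠ 0 := hne
    rw [spectrum.mem_iff] at hz
    apply hz
    have := (h z⁻¹).smul (Units.mk0 z hne)
    rw [Units.smul_mk0, smul_sub, smul_smul, mul_inv_cancel₀ hne, one_smul] at this
    rwa [Algebra.algebraMap_eq_smul_one]
  · intro h c
    by_cases hc : c = 0
    · simp [hc]
    · have h1 : c⁻¹ ∉ spectrum ℂ q := fun h2 => inv_ne_zero hc (h h2)
      rw [spectrum.notMem_iff] at h1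
      have := h1.smul (Units.mk0 c hc)
      rwa [Units.smul_mk0, smul_sub, Algebra.algebraMap_eq_smul_one, smul_smul,
        mul_inv_cancel₀ hc, one_smul] at this

theorem IsQuasinilpotent.qn {q : A} (h : IsQuasinilpotent q) : Qn q :=
  (qn_iff_spec q).2 (by rw [IsQuasinilpotent] at h; rw [h])

theorem Qn.isQuasinilpotent [Nontrivial A] {q : A} (h : Qn q) : IsQuasinilpotent q := by
  have h1 := (qn_iff_spec q).1 h
  exact (Set.Nonempty.subset_singleton_iff (spectrum.nonempty q)).1 h1

theorem Qn.bound {q : A} (h : Qn q) {ε : ℝ} (hε : 0 < ε) :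
    ∃ C : ℝ, 0 ≤ C ∧ ∀ k : ℕ, ‖q ^ k‖ ≤ C * ε ^ k := by
  have hs : spectralRadius ℂ q = 0 := by
    have h1 := (qn_iff_spec q).1 h
    rw [spectralRadius]
    simp only [ENNReal.iSup_eq_zero]
    intro z hz
    have : z = 0 := h1 hz
    simp [this]
  have ht := spectrum.pow_norm_pow_one_div_tendsto_nhds_spectralRadius q
  rw [hs] at ht
  have hev := (ht.eventually (gt_mem_nhds (ENNReal.ofReal_pos.2 hε))).and
    (Filter.eventually_gt_atTop 0)
  have hb : Filter.IsBoundedUnder (· ≤ ·) Filter.atTop (fun k : ℕ => ‖q ^ k‖ / ε ^ k) := by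
    refine ⟨1, ?_⟩
    rw [Filter.eventually_map]
    filter_upwards [hev] with k hk
    obtain ⟨hk, hk0⟩ := hk
    rw [ENNReal.ofReal_lt_ofReal_iff hε] at hk
    rw [div_le_one (by positivity)]
    have h2 : (‖q ^ k‖ ^ (1 / k : ℝ)) ^ k ≤ ε ^ k := by
      gcongr
    rwa [one_div, Real.rpow_inv_natCast_pow (norm_nonneg _) hk0.ne'] at h2
  obtain ⟨C, hC⟩ := hb.bddAbove_range
  have hC' : ∀ k, ‖q ^ k‖ / ε ^ k ≤ C := fun k => hC ⟨k, rfl⟩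
  refine ⟨C, ?_, fun k => ?_⟩
  · exact le_trans (by positivity) (hC' 0)
  · exact (div_le_iff₀ (by positivity)).1 (hC' k)

theorem unit_of_pow {u : A} {n : ℕ} (h : IsUnit (1 - u ^ n)) : IsUnit (1 - u) := by
  have h1 := mul_neg_geom_sum u n
  have h2 := geom_sum_mul_neg u n
  have hc : Commute (1 - u) (∑ i ∈ Finset.range n, u ^ i) := by
    rw [Commute, SemiconjBy, h1, h2]
  rw [← h1] at h
  exact (hc.isUnit_mul_iff.1 h).1

theorem Qn.of_bound {q : A}
    (h : ∀ ε : ℝ, 0 < ε → ∃ C : ℝ, 0 ≤ C ∧ ∀ k : ℕ, ‖q ^ k‖ ≤ C * ε ^ k) : Qn q := by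
  intro c
  have hpos : 0 < (2 * (‖c‖ + 1))⁻¹ := by positivity
  obtain ⟨C, hC0, hC⟩ := h _ hpos
  obtain ⟨k, hk⟩ := exists_pow_lt_of_lt_one (show (0:ℝ) < (C + 1)⁻¹ by positivity)
    (show (1/2 : ℝ) < 1 by norm_num)
  apply unit_of_pow (n := k)
  apply isUnit_one_sub_of_norm_lt_one
  rw [smul_pow, norm_smul, norm_pow]
  calc ‖c‖ ^ k * ‖q ^ k‖ ≤ (‖c‖ + 1) ^ k * (C * (2 * (‖c‖ + 1))⁻¹ ^ k) := by
        gcongr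
        · linarith
        · exact hC k
    _ = C * (1/2) ^ k := by
        have : (2 * (‖c‖ + 1))⁻¹ = (1/2) * (‖c‖ + 1)⁻¹ := by
          rw [mul_inv]; norm_num
        rw [this, mul_pow, inv_pow]
        have : (‖c‖ + 1) ^ k ≠ 0 := by positivity
        field_simp
    _ ≤ C * (C + 1)⁻¹ := by gcongr
    _ < 1 := by
        rw [← div_eq_mul_inv, div_lt_one (by positivity)]; linarith

theorem Qn.mul_left {e u : A} (hu : Qn u) (hc : Commute e u) : Qn (e * u) := by
  apply Qn.of_bound
  intro ε hε
  have hpos : 0 < ε / (‖e‖ + 1) := by positivity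
  obtain ⟨C, hC0, hC⟩ := hu.bound hpos
  refine ⟨‖(1:A)‖ * C + C, by positivity, fun k => ?_⟩
  have he : ‖e ^ k‖ ≤ (‖(1:A)‖ + 1) * (‖e‖ + 1) ^ k := by
    rcases Nat.eq_zero_or_pos k with rfl | hk
    · simp
    · calc ‖e ^ k‖ ≤ ‖e‖ ^ k := norm_pow_le' e hk
        _ ≤ (‖e‖ + 1) ^ k := by gcongr; linarith
        _ ≤ (‖(1:A)‖ + 1) * (‖e‖ + 1) ^ k := by
          apply le_mul_of_one_le_left (by positivity)
          linarith [norm_nonneg (1:A)]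
  rw [hc.mul_pow]
  calc ‖e ^ k * u ^ k‖ ≤ ‖e ^ k‖ * ‖u ^ k‖ := norm_mul_le _ _
    _ ≤ ((‖(1:A)‖ + 1) * (‖e‖ + 1) ^ k) * (C * (ε / (‖e‖ + 1)) ^ k) := by
        gcongr; exact hC k
    _ = _ := by
        rw [div_pow]
        have : (‖e‖ + 1) ^ k ≠ 0 := by positivity
        field_simp

theorem Qn.add {u v : A} (hu : Qn u) (hv : Qn v) (hc : Commute u v) : Qn (u + v) := by
  apply Qn.of_bound
  intro ε hε
  obtain ⟨C, hC0, hC⟩ := hu.bound (half_pos hε)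
  obtain ⟨D, hD0, hD⟩ := hv.bound (half_pos hε)
  refine ⟨C * D, by positivity, fun k => ?_⟩
  rw [hc.add_pow]
  calc _ ≤ ∑ m ∈ Finset.range (k + 1), ‖u ^ m * v ^ (k - m) * (k.choose m : A)‖ :=
        norm_sum_le _ _
    _ ≤ ∑ m ∈ Finset.range (k + 1), (C * D) * ((ε/2) ^ m * (ε/2) ^ (k - m) * (k.choose m : ℝ)) := by
        apply Finset.sum_le_sum
        intro m _
        rw [← nsmul_eq_mul']
        calc _ ≤ (k.choose m : ℝ) * ‖u ^ m * v ^ (k - m)‖ := norm_nsmul_le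
          _ ≤ (k.choose m : ℝ) * ((C * (ε/2)^m) * (D * (ε/2)^(k-m))) := by
              gcongr
              refine (norm_mul_le _ _).trans ?_
              gcongr
              · exact hC m
              · exact hD _
          _ = _ := by ring
    _ = _ := by
        rw [← Finset.mul_sum, ← add_pow, add_halves]

theorem Qn.of_pow {u : A} {n : ℕ} (hu : Qn (u ^ n)) : Qn u := by
  intro c
  apply unit_of_pow (n := n)
  rw [smul_pow]
  exact hu _

theorem Qn.pow {u : A} {n : ℕ} (hn : 1 ≤ n) (hu : Qn u) : Qn (u ^ n) := by
  obtain ⟨m, rfl⟩ := Nat.exists_eq_add_of_le' hn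
  rw [pow_succ]
  exact hu.mul_left ((Commute.refl u).pow_left m)

theorem Qn.swap {u v : A} (h : Qn (u * v)) : Qn (v * u) := by
  intro c
  obtain ⟨w, hw⟩ := h c
  have h1 := w.mul_inv
  have h2 := w.inv_mul
  rw [hw] at h1 h2
  set i : A := ↑w⁻¹
  have h1' : i = 1 + c • (u * v * i) := by
    rw [sub_mul, one_mul, smul_mul_assoc] at h1
    rw [← h1]; abel
  have h2' : i = 1 + c • (i * (u * v)) := by
    rw [mul_sub, mul_one, mul_smul_comm] at h2
    rw [← h2]; abel
  refine ⟨⟨1 - c • (v * u), 1 + c • (v * i * u), ?_, ?_⟩, rfl⟩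
  · have : v * i * u = v * u + c • (v * u * (v * i * u)) := by
      conv_lhs => rw [h1']
      simp [mul_add, add_mul, mul_assoc]
    rw [sub_mul, one_mul, mul_add, mul_one, smul_mul_assoc, mul_smul_comm]
    conv_lhs => enter [1,2]; rw [this]
    rw [smul_add]; abel
  · have : v * i * u = v * u + c • (v * i * u * (v * u)) := by
      conv_lhs => rw [h2']
      simp [mul_add, add_mul, mul_assoc]
    rw [mul_sub, mul_one, add_mul, one_mul, smul_mul_assoc, mul_smul_comm]
    conv_lhs => enter [1,2]; rw [this]
    rw [smul_add]; abel

theorem Qn.tri {u e : A} (he : e * e = e) (ht : u * e = e * u * e)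
    (h1 : Qn (e * u * e)) (h2 : Qn ((1 - e) * u * (1 - e))) : Qn u := by
  intro c
  have he1 : (1 - e) * e = 0 := by rw [sub_mul, he, one_mul, sub_self]
  set α := e * u * e with hα
  set β := e * u * (1 - e) with hβ
  set γ := (1 - e) * u * (1 - e) with hγ
  have hββ : β * β = 0 := by
    calc _ = e * u * ((1 - e) * e) * u * (1 - e) := by rw [hβ]; noncomm_ring
      _ = 0 := by rw [he1]; simp
  have hβα : β * α = 0 := by
    calc _ = e * u * ((1 - e) * e) * u * e := by rw [hβ, hα]; noncomm_ring
      _ = 0 := by rw [he1]; simp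
  have hγβ : γ * β = 0 := by
    calc _ = (1 - e) * u * ((1 - e) * e) * u * (1 - e) := by rw [hβ, hγ]; noncomm_ring
      _ = 0 := by rw [he1]; simp
  have hγα : γ * α = 0 := by
    calc _ = (1 - e) * u * ((1 - e) * e) * u * e := by rw [hα, hγ]; noncomm_ring
      _ = 0 := by rw [he1]; simp
  have hu : u = α + β + γ := by
    have : α + β + γ = e * u * e + (u - u * e) := by
      rw [hα, hβ, hγ]
      have : (1 - e) * u * (1 - e) = u - e * u - u * e + e * u * e := by noncomm_ring
      rw [this, mul_sub, mul_one]; abel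
    rw [this, ← hα, ← ht]; abel
  have hβu : IsUnit (1 - c • β) := by
    refine ⟨⟨1 - c • β, 1 + c • β, ?_, ?_⟩, rfl⟩
    · simp [sub_mul, mul_add, hββ]
    · simp [mul_sub, add_mul, hββ]
  have key : 1 - c • u = (1 - c • γ) * ((1 - c • β) * (1 - c • α)) := by
    have e1 : (1 - c • β) * (1 - c • α) = 1 - c • β - c • α := by
      simp [mul_sub, sub_mul, hβα]
    rw [e1, hu]
    simp [mul_sub, sub_mul, hγα, hγβ, smul_add]
    abel
  rw [key]
  exact (h2 c).mul (hβu.mul (h1 c))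

theorem pow_bound (e : A) (k : ℕ) : ‖e ^ k‖ ≤ (‖(1:A)‖ + 1) * (‖e‖ + 1) ^ k := by
  rcases Nat.eq_zero_or_pos k with rfl | hk
  · simp
  · calc ‖e ^ k‖ ≤ ‖e‖ ^ k := norm_pow_le' e hk
      _ ≤ (‖e‖ + 1) ^ k := by gcongr; linarith
      _ ≤ (‖(1:A)‖ + 1) * (‖e‖ + 1) ^ k := by
        apply le_mul_of_one_le_left (by positivity)
        linarith [norm_nonneg (1:A)]

theorem Qn.mixed_bound {N : A} (hN : Qn N) (w : A) :
    ∃ C : ℝ, 0 ≤ C ∧ ∀ k : ℕ, ‖N ^ k‖ * ‖w ^ k‖ ≤ C * (1/2) ^ k := by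
  have hpos : 0 < (1/2) / (‖w‖ + 1) := by positivity
  obtain ⟨C, hC0, hC⟩ := hN.bound hpos
  refine ⟨C * (‖(1:A)‖ + 1), by positivity, fun k => ?_⟩
  calc ‖N ^ k‖ * ‖w ^ k‖
      ≤ (C * ((1/2) / (‖w‖ + 1)) ^ k) * ((‖(1:A)‖ + 1) * (‖w‖ + 1) ^ k) := by
        gcongr
        · exact hC k
        · exact pow_bound w k
    _ = _ := by
        rw [div_pow]
        have : (‖w‖ + 1) ^ k ≠ 0 := by positivity
        field_simp

theorem Qn.zero_of {N : A} (hN : Qn N) (w t : A) (K : ℝ) (hK : 0 ≤ K)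
    (h : ∀ k : ℕ, ‖t‖ ≤ K * (‖N ^ k‖ * ‖w ^ k‖)) : t = 0 := by
  obtain ⟨C, hC0, hC⟩ := hN.mixed_bound w
  have h1 : ∀ k : ℕ, ‖t‖ ≤ K * C * (1/2) ^ k := fun k => by
    refine (h k).trans ?_
    rw [mul_assoc]
    exact mul_le_mul_of_nonneg_left (hC k) hK
  have h2 : Filter.Tendsto (fun k : ℕ => K * C * (1/2 : ℝ) ^ k) Filter.atTop (nhds (K * C * 0)) :=
    (tendsto_pow_atTop_nhds_zero_of_lt_one (by norm_num) (by norm_num)).const_mul _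
  rw [mul_zero] at h2
  have := ge_of_tendsto' h2 h1
  exact norm_le_zero_iff.1 this

theorem qn_comp {n : ℕ} (s x : A) (hc : s * x = x * s) (hx : x * s * x = x)
    (hq : Qn (s ^ n - s * x)) : Qn ((1 - s * x) * s) := by
  obtain ⟨P, hP⟩ : ∃ P, P = s * x := ⟨_, rfl⟩
  rw [← hP] at hq
  have hPP : P * P = P := by
    calc P * P = s * (x * s * x) := by rw [hP]; noncomm_ring
      _ = P := by rw [hx, hP]
  have hsP : Commute s P := by
    rw [Commute, SemiconjBy, hP, mul_assoc, ← hc]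
  have hxP : Commute x P := by
    rw [Commute, SemiconjBy, hP, ← mul_assoc, hc]
  have hPx : P * x = x := by rw [← hxP.eq, hP, ← mul_assoc, hx]
  have hcP : Commute (1 - P) s := ((Commute.one_right s).sub_right hsP).symm
  have hi : (1 - P) * (1 - P) = 1 - P := by
    have : (1 - P) * (1 - P) = 1 - P - P + P * P := by noncomm_ring
    rw [this, hPP]; abel
  have hi0 : (1 - P) * P = 0 := by rw [sub_mul, hPP, one_mul, sub_self]
  have hN : Qn ((1 - P) * s) := by
    apply Qn.of_pow (n := n + 1)
    have h1 : Qn (((1 - P) * s) * (s ^ n - P)) := by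
      apply hq.mul_left
      have c1 : Commute s (s ^ n - P) := ((Commute.refl s).pow_right n).sub_right hsP
      have c2 : Commute (1 - P) (s ^ n - P) :=
        (hcP.pow_right n).sub_right (((Commute.one_left P).sub_left (Commute.refl P)))
      exact c2.mul_left c1
    have : ((1 - P) * s) * (s ^ n - P) = ((1 - P) * s) ^ (n + 1) := by
      rw [hcP.mul_pow, mul_sub, mul_assoc _ s P, hsP.eq, ← mul_assoc _ P s, hi0, zero_mul, sub_zero,
        mul_assoc, ← pow_succ']
      congr 1
      have : ∀ m : ℕ, (1 - P) ^ (m + 1) = 1 - P := by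
        intro m
        induction m with
        | zero => simp
        | succ m ih => rw [pow_succ, ih, hi]
      rw [this]
    rwa [this] at h1
  rw [← hP]; exact hN

theorem bicomm {n : ℕ} (s x : A) (hc : s * x = x * s) (hx : x * s * x = x)
    (hq : Qn (s ^ n - s * x)) (z : A) (hz : z * s = s * z) : x * z = z * x := by
  have hN := qn_comp s x hc hx hq
  obtain ⟨P, hP⟩ : ∃ P, P = s * x := ⟨_, rfl⟩
  rw [← hP] at hq hN
  have hPP : P * P = P := by
    calc P * P = s * (x * s * x) := by rw [hP]; noncomm_ring
      _ = P := by rw [hx, hP]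
  have hsP : Commute s P := by
    rw [Commute, SemiconjBy, hP, mul_assoc, ← hc]
  have hxP : Commute x P := by
    rw [Commute, SemiconjBy, hP, ← mul_assoc, hc]
  have hPx : P * x = x := by rw [← hxP.eq, hP, ← mul_assoc, hx]
  have hcP : Commute (1 - P) s := ((Commute.one_right s).sub_right hsP).symm
  have hi : (1 - P) * (1 - P) = 1 - P := by
    have : (1 - P) * (1 - P) = 1 - P - P + P * P := by noncomm_ring
    rw [this, hPP]; abel
  have hi0 : (1 - P) * P = 0 := by rw [sub_mul, hPP, one_mul, sub_self]
  have hPk : ∀ k : ℕ, s ^ k * x ^ k * P = P := by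
    intro k
    induction k with
    | zero => simp
    | succ k ih =>
      have : s ^ (k + 1) * x ^ (k + 1) * P = s ^ k * ((s * x) * x ^ k) * P := by
        rw [pow_succ, pow_succ']; noncomm_ring
      rw [this, ← hP, ← (hxP.pow_left k).eq, ← mul_assoc, mul_assoc _ P P, hPP, ih]
  have hNk : ∀ k : ℕ, (1 - P) * s ^ k = ((1 - P) * s) ^ k * (1 - P) := by
    intro k
    induction k with
    | zero => simp
    | succ k ih =>
      rw [pow_succ, ← mul_assoc, ih, pow_succ]
      rw [mul_assoc, mul_assoc, mul_assoc _ s (1 - P), ← hcP.eq, ← mul_assoc (1-P) (1-P) s, hi]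
  have hzk : ∀ k : ℕ, z * s ^ k = s ^ k * z := fun k => (Commute.pow_right (show Commute z s from hz) k).eq
  have hsx : ∀ k : ℕ, s ^ k * x ^ k = x ^ k * s ^ k :=
    fun k => (Commute.pow_pow (show Commute s x from hc) k k).eq
  have hPsx : ∀ k : ℕ, Commute P (x ^ k) := fun k => (hxP.pow_left k).symm
  have hPss : ∀ k : ℕ, Commute P (s ^ k) := fun k => (hsP.pow_left k).symm
  have z1 : (1 - P) * z * P = 0 := by
    apply hN.zero_of x _ (‖(1 - P) * z‖ * ‖P‖) (by positivity)
    intro k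
    have : (1 - P) * z * P = ((1 - P) * s) ^ k * ((1 - P) * z) * x ^ k * P := by
      calc (1 - P) * z * P = (1 - P) * z * (s ^ k * x ^ k * P) := by rw [hPk]
        _ = (1 - P) * (z * s ^ k) * x ^ k * P := by noncomm_ring
        _ = ((1 - P) * s ^ k) * z * x ^ k * P := by rw [hzk]; noncomm_ring
        _ = _ := by rw [hNk]; noncomm_ring
    rw [this]
    calc _ ≤ ‖((1 - P) * s) ^ k‖ * ‖(1 - P) * z‖ * ‖x ^ k‖ * ‖P‖ := by
          refine (norm_mul_le _ _).trans ?_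
          gcongr
          refine (norm_mul_le _ _).trans ?_
          gcongr
          exact norm_mul_le _ _
      _ = _ := by ring
  have z2 : P * z * (1 - P) = 0 := by
    apply hN.zero_of x _ (‖z * (1 - P)‖ * ‖P‖) (by positivity)
    intro k
    have : P * z * (1 - P) = P * x ^ k * (z * (1 - P)) * ((1 - P) * s) ^ k := by
      have hsw : s ^ k * (1 - P) = (1 - P) * ((1 - P) * s) ^ k := by
        rw [← (hcP.pow_right k).eq, hNk]
        have : Commute (1 - P) ((1 - P) * s) := (Commute.refl _).mul_right hcP
        rw [(this.pow_right k).eq]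
      calc P * z * (1 - P) = (P * (s ^ k * x ^ k)) * z * (1 - P) := by
            rw [((hPss k).mul_right (hPsx k)).eq, hPk]
        _ = P * x ^ k * (s ^ k * z) * (1 - P) := by rw [hsx]; noncomm_ring
        _ = P * x ^ k * z * (s ^ k * (1 - P)) := by rw [← hzk]; noncomm_ring
        _ = _ := by rw [hsw]; noncomm_ring
    rw [this]
    calc _ ≤ ‖P‖ * ‖x ^ k‖ * ‖z * (1 - P)‖ * ‖((1 - P) * s) ^ k‖ := by
          refine (norm_mul_le _ _).trans ?_
          gcongr
          refine (norm_mul_le _ _).trans ?_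
          gcongr
          exact norm_mul_le _ _
      _ = _ := by ring
  have hzP : z * P = P * z := by
    have e1 : z * P = P * z * P := by
      have : (1 - P) * z * P = z * P - P * z * P := by noncomm_ring
      rw [this] at z1
      exact sub_eq_zero.1 z1
    have e2 : P * z = P * z * P := by
      rw [mul_sub, mul_one] at z2
      exact sub_eq_zero.1 z2
    rw [e1, ← e2]
  calc x * z = (x * P) * z := by rw [hxP.eq, hPx]
    _ = x * (z * P) := by rw [hzP]; noncomm_ring
    _ = x * (z * s) * x := by rw [hP]; noncomm_ring
    _ = (x * s) * z * x := by rw [hz]; noncomm_ring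
    _ = z * (P * x) := by rw [← hc, ← hP, ← hzP]; noncomm_ring
    _ = z * x := by rw [hPx]

theorem core {n : ℕ} (hn : 1 ≤ n) (s e w : A) (he : e * e = e) (hse : s * e = e * s * e)
    (hwe : w * e = w) (hew : e * w = w) (hwse : w * s * e = e) (hsw : s * w = e)
    (hN : Qn ((1 - e) * s)) (hB : Qn (s ^ n * e - e)) :
    ∃ x, s * x = x * s ∧ x * s * x = x ∧ Qn (s ^ n - s * x) := by
  set N := (1 - e) * s with hNdef
  have hNe : N * (1 - e) = N := by
    have : N * (1 - e) = (1 - e) * s - (s * e - e * s * e) := by rw [hNdef]; noncomm_ring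
    rw [this, ← hse, sub_self, sub_zero]
  have hNk : ∀ k : ℕ, (1 - e) * s ^ k = N ^ k * (1 - e) := by
    intro k
    induction k with
    | zero => simp
    | succ k ih =>
      rw [pow_succ, ← mul_assoc, ih, pow_succ, mul_assoc, mul_assoc, hNe]
  have hske : ∀ k : ℕ, s ^ k * e = e * s ^ k * e := by
    intro k
    have h1 := hNk k
    have h2 : (1 - e) * e = 0 := by rw [sub_mul, he, one_mul, sub_self]
    have h3 : (1 - e) * s ^ k * e = 0 := by rw [h1, mul_assoc, h2, mul_zero]
    rw [sub_mul, sub_mul, one_mul] at h3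
    exact sub_eq_zero.1 h3
  have hwk : ∀ k : ℕ, e * w ^ k * e = e * w ^ k := by
    intro k
    rcases k with _ | k
    · simp [he]
    · rw [pow_succ, mul_assoc, mul_assoc, hwe]
  set f : ℕ → A := fun k => e * w ^ k * s ^ k with hf
  have hdiff : ∀ k, f (k + 1) - f k = e * w ^ k * (w * s) * N ^ k * (1 - e) := by
    intro k
    have h1 : w * s - e = w * s * (1 - e) := by rw [mul_sub, mul_one, hwse]
    calc f (k + 1) - f k = e * w ^ k * (w * s) * s ^ k - (e * w ^ k * e) * s ^ k := by
          rw [hwk]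
          simp only [hf]
          rw [pow_succ, pow_succ']; noncomm_ring
      _ = e * w ^ k * (w * s - e) * s ^ k := by noncomm_ring
      _ = e * w ^ k * (w * s) * ((1 - e) * s ^ k) := by rw [h1]; noncomm_ring
      _ = _ := by rw [hNk]; noncomm_ring
  obtain ⟨C, hC0, hC⟩ := hN.mixed_bound w
  have hcau : CauchySeq f := by
    apply cauchySeq_of_le_geometric (1/2) (‖e‖ * ‖w * s‖ * ‖1 - e‖ * C) (by norm_num)
    intro k
    rw [dist_comm, dist_eq_norm, hdiff]
    calc _ ≤ ‖e‖ * ‖w ^ k‖ * ‖w * s‖ * ‖N ^ k‖ * ‖1 - e‖ := by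
          refine (norm_mul_le _ _).trans ?_
          gcongr
          refine (norm_mul_le _ _).trans ?_
          gcongr
          refine (norm_mul_le _ _).trans ?_
          gcongr
          exact norm_mul_le _ _
      _ = ‖e‖ * ‖w * s‖ * ‖1 - e‖ * (‖N ^ k‖ * ‖w ^ k‖) := by ring
      _ ≤ ‖e‖ * ‖w * s‖ * ‖1 - e‖ * (C * (1/2) ^ k) := by
          exact mul_le_mul_of_nonneg_left (hC k) (by positivity)
      _ = _ := by ring
  obtain ⟨P, hP⟩ := cauchySeq_tendsto_of_complete hcau
  have heP : e * P = P := by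
    refine tendsto_nhds_unique (hP.const_mul e) (hP.congr fun k => ?_)
    simp only [hf]
    rw [← mul_assoc, ← mul_assoc, he]
  have hPe : P * e = e := by
    refine tendsto_nhds_unique (hP.mul_const e) (tendsto_const_nhds.congr fun k => ?_)
    simp only [hf]
    induction k with
    | zero => simp [he]
    | succ k ih =>
      have h1 : e * w ^ (k + 1) * s ^ (k + 1) * e = e * w ^ k * (w * s * (s ^ k * e)) := by
        rw [pow_succ, pow_succ']; noncomm_ring
      rw [h1, hske]
      have h2 : e * w ^ k * (w * s * (e * s ^ k * e)) = e * w ^ k * ((w * s * e) * s ^ k * e) := by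
        noncomm_ring
      rw [h2, hwse, ← hske, ← mul_assoc]
      exact ih
  have hsP : s * P = P * s := by
    have h1 := (hP.comp (Filter.tendsto_add_atTop_nat 1)).const_mul s
    refine tendsto_nhds_unique h1 ((hP.mul_const s).congr fun k => ?_)
    simp only [hf, Function.comp]
    have h2 : s * (e * w ^ (k + 1) * s ^ (k + 1)) = s * (e * w) * w ^ k * s ^ (k + 1) := by
      rw [pow_succ']; noncomm_ring
    rw [h2, hew, hsw, pow_succ]; noncomm_ring
  have hsx : s * (w * P) = P := by rw [← mul_assoc, hsw, heP]
  have hxs : w * P * s = P := by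
    rw [mul_assoc, ← hsP]
    calc w * (s * P) = w * (s * (e * P)) := by rw [heP]
      _ = (w * s * e) * P := by noncomm_ring
      _ = P := by rw [hwse, heP]
  refine ⟨w * P, by rw [hsx, hxs], ?_, ?_⟩
  · rw [hxs, ← mul_assoc, ← hew, ← mul_assoc P, hPe]
  · rw [hsx]
    have h0 : e * (s ^ n - P) * e = s ^ n * e - e := by
      rw [mul_sub, sub_mul, ← hske, heP, hPe]
    have h1 : (s ^ n - P) * e = e * (s ^ n - P) * e := by
      rw [h0, sub_mul, hPe]
    refine Qn.tri he h1 (by rwa [h0]) ?_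
    have h2 : (1 - e) * (s ^ n - P) * (1 - e) = N ^ n := by
      obtain ⟨m, rfl⟩ := Nat.exists_eq_add_of_le' hn
      have : (1 - e) * P = 0 := by rw [sub_mul, heP, one_mul, sub_self]
      rw [mul_sub (1 - e) (s ^ (m + 1)) P, this, sub_zero, hNk, pow_succ, mul_assoc, mul_assoc, ← mul_assoc N, hNe, hNe]
    rw [h2]
    exact hN.pow hn

theorem main_aux (n : ℕ) (hn : 1 ≤ n) (a b x y : A)
    (cx : x * a = a * x) (hx : x * a * x = x) (hxq : Qn (a ^ n - a * x))
    (cy : y * b = b * y) (hy : y * b * y = y) (hyq : Qn (b ^ n - b * y))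
    (h1 : a = a * (1 - b * y))
    (h2 : (1 - b * y) * b * (1 - a * x) = (1 - b * y) * b)
    (h3 : (1 - b * y) * (1 - a * x) * b * a = (1 - b * y) * (1 - a * x) * a * b) :
    ∃ z, (a + b) * z = z * (a + b) ∧ z * (a + b) * z = z ∧ Qn ((a + b) ^ n - (a + b) * z) := by
  have tl : ∀ u v r : A, u * v = r → ∀ t, u * (v * t) = r * t := by
    intro u v r h t; rw [← h, mul_assoc]
  have tl3 : ∀ u v w r : A, u * (v * w) = r → ∀ t, u * (v * (w * t)) = r * t := by
    intro u v w r h t; rw [← h]; simp only [mul_assoc]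
  have tl4 : ∀ u v w q r : A, u * (v * (w * q)) = r → ∀ t, u * (v * (w * (q * t))) = r * t := by
    intro u v w q r h t; rw [← h]; simp only [mul_assoc]
  have tl5 : ∀ u v w q p r : A, u * (v * (w * (q * p))) = r →
      ∀ t, u * (v * (w * (q * (p * t)))) = r * t := by
    intro u v w q p r h t; rw [← h]; simp only [mul_assoc]
  have r3 : a * (x * x) = x := by rw [← mul_assoc, ← cx, hx]
  have r4 : b * (y * y) = y := by rw [← mul_assoc, ← cy, hy]
  have r6 : a * (b * y) = 0 := by
    rw [mul_sub, mul_one] at h1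
    have := sub_eq_self.1 h1.symm
    exact this
  have r5 : a * y = 0 := by
    rw [← r4, tl3 _ _ _ _ r6, zero_mul]
  have xe : x = x * x * a := by
    rw [mul_assoc, cx, ← mul_assoc, cx, mul_assoc, r3]
  have r5' : x * y = 0 := by rw [xe, mul_assoc, r5, mul_zero]
  have r6' : x * (b * y) = 0 := by
    rw [xe, mul_assoc, r6, mul_zero]
  have r7 : b * (b * (y * (a * x))) = b * (a * x) := by
    rw [mul_sub, mul_one] at h2
    have h4 := sub_eq_self.1 h2
    rw [sub_mul, one_mul, sub_mul, sub_eq_zero] at h4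
    rw [h4, mul_assoc, mul_assoc, tl _ _ _ cy, mul_assoc]
  have r7' : b * (b * (y * x)) = b * x := by
    have := tl5 _ _ _ _ _ _ r7 x
    simpa only [mul_assoc, r3] using this
  have r7'' : b * (b * (y * (a * (a * x)))) = b * (a * (a * x)) := by
    have := tl5 _ _ _ _ _ _ r7 a
    simpa only [mul_assoc, cx] using this
  have abby : ∀ t, a * (b * (b * (y * t))) = 0 := by
    intro t
    rw [← tl _ _ _ cy |> fun h => (h t).trans (mul_assoc _ _ _), tl3 _ _ _ _ r6, zero_mul]
  have xbby : ∀ t, x * (b * (b * (y * t))) = 0 := by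
    intro t
    rw [xe, mul_assoc, abby, mul_zero]
  have abby0 : a * (b * (b * y)) = 0 := by rw [← cy, ← mul_assoc b, ← mul_assoc a, r6, zero_mul]
  have xbby0 : x * (b * (b * y)) = 0 := by rw [← cy, ← mul_assoc b, ← mul_assoc x, r6', zero_mul]
  have r8 : a * (b * (a * x)) = 0 := by rw [← r7, abby]
  have r8x : x * (b * (a * x)) = 0 := by rw [← r7, xbby]
  have r9 : a * (b * x) = 0 := by rw [← r7', abby]
  have r9x : x * (b * x) = 0 := by rw [← r7', xbby]
  have t1 := tl _ _ _ cx
  have t2 := tl _ _ _ cy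
  have t3 := tl3 _ _ _ _ r3
  have t4 := tl3 _ _ _ _ r4
  have t5 := tl _ _ _ r5
  have t5' := tl _ _ _ r5'
  have t6 := tl3 _ _ _ _ r6
  have t6' := tl3 _ _ _ _ r6'
  have t7 := tl5 _ _ _ _ _ _ r7
  have t7' := tl4 _ _ _ _ _ r7'
  have t8 := tl4 _ _ _ _ _ r8
  have t8x := tl4 _ _ _ _ _ r8x
  have t9 := tl3 _ _ _ _ r9
  have t9x := tl3 _ _ _ _ r9x
  simp only [mul_assoc] at t1 t2 t7 t7'
  have eE : b * y + (1 - b * y) * (a * x) = b * y + a * x - b * (y * (a * x)) := by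
    rw [sub_mul, one_mul, mul_assoc]; abel
  have eG : (1 - b * y) * (1 - a * x) = 1 - (b * y + a * x - b * (y * (a * x))) := by
    rw [← eE]; noncomm_ring
  have hqa := qn_comp a x cx.symm hx hxq
  have hqb := qn_comp b y cy.symm hy hyq
  set e := b * y + a * x - b * (y * (a * x)) with he
  set w := y + x - b * (y * x) - y * (a * x) with hw
  refine core hn (a + b) e w ?_ ?_ ?_ ?_ ?_ ?_ ?_ ?_
  · simp only [he, mul_add, add_mul, mul_sub, sub_mul, mul_assoc, cx, cy, r3, r4, r5, r5', r6, r6', r7, r7', r7'', r8, r8x, r9, r9x, abby0, xbby0, abby, xbby, t1, t2, t3, t4, t5, t5', t6, t6', t7, t7', t8, t8x, t9, t9x, zero_mul, mul_zero, mul_one, one_mul]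
    abel
  · simp only [he, mul_add, add_mul, mul_sub, sub_mul, mul_assoc, cx, cy, r3, r4, r5, r5', r6, r6', r7, r7', r7'', r8, r8x, r9, r9x, abby0, xbby0, abby, xbby, t1, t2, t3, t4, t5, t5', t6, t6', t7, t7', t8, t8x, t9, t9x, zero_mul, mul_zero, mul_one, one_mul]
    abel
  · simp only [he, hw, mul_add, add_mul, mul_sub, sub_mul, mul_assoc, cx, cy, r3, r4, r5, r5', r6, r6', r7, r7', r7'', r8, r8x, r9, r9x, abby0, xbby0, abby, xbby, t1, t2, t3, t4, t5, t5', t6, t6', t7, t7', t8, t8x, t9, t9x, zero_mul, mul_zero, mul_one, one_mul]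
    abel
  · simp only [he, hw, mul_add, add_mul, mul_sub, sub_mul, mul_assoc, cx, cy, r3, r4, r5, r5', r6, r6', r7, r7', r7'', r8, r8x, r9, r9x, abby0, xbby0, abby, xbby, t1, t2, t3, t4, t5, t5', t6, t6', t7, t7', t8, t8x, t9, t9x, zero_mul, mul_zero, mul_one, one_mul]
    abel
  · simp only [he, hw, mul_add, add_mul, mul_sub, sub_mul, mul_assoc, cx, cy, r3, r4, r5, r5', r6, r6', r7, r7', r7'', r8, r8x, r9, r9x, abby0, xbby0, abby, xbby, t1, t2, t3, t4, t5, t5', t6, t6', t7, t7', t8, t8x, t9, t9x, zero_mul, mul_zero, mul_one, one_mul]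
    abel
  · simp only [he, hw, mul_add, add_mul, mul_sub, sub_mul, mul_assoc, cx, cy, r3, r4, r5, r5', r6, r6', r7, r7', r7'', r8, r8x, r9, r9x, abby0, xbby0, abby, xbby, t1, t2, t3, t4, t5, t5', t6, t6', t7, t7', t8, t8x, t9, t9x, zero_mul, mul_zero, mul_one, one_mul]
    abel
  · have gag : (1 - e) * a * (1 - e) = (1 - e) * a := by
      simp only [he, mul_add, add_mul, mul_sub, sub_mul, mul_assoc, cx, cy, r3, r4, r5, r5', r6, r6', r7, r7', r7'', r8, r8x, r9, r9x, abby0, xbby0, abby, xbby, t1, t2, t3, t4, t5, t5', t6, t6', t7, t7', t8, t8x, t9, t9x, zero_mul, mul_zero, mul_one, one_mul]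
      abel
    have gbg : (1 - e) * b * (1 - e) = (1 - e) * b := by
      simp only [he, mul_add, add_mul, mul_sub, sub_mul, mul_assoc, cx, cy, r3, r4, r5, r5', r6, r6', r7, r7', r7'', r8, r8x, r9, r9x, abby0, xbby0, abby, xbby, t1, t2, t3, t4, t5, t5', t6, t6', t7, t7', t8, t8x, t9, t9x, zero_mul, mul_zero, mul_one, one_mul]
      abel
    rw [eG] at h3
    rw [mul_add]
    apply Qn.add
    · have : Qn ((1 - b * y) * ((1 - a * x) * a)) := by
        apply Qn.swap
        have : (1 - a * x) * a * (1 - b * y) = (1 - a * x) * a := by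
          rw [mul_assoc, ← h1]
        rwa [this]
      rwa [← mul_assoc, eG] at this
    · have k1 : Qn ((1 - e) * ((1 - b * y) * b)) := by
        apply Qn.swap
        have : (1 - b * y) * b * (1 - e) = (1 - b * y) * b := by
          simp only [he, mul_add, add_mul, mul_sub, sub_mul, mul_assoc, cx, cy, r3, r4, r5, r5', r6, r6', r7, r7', r7'', r8, r8x, r9, r9x, abby0, xbby0, abby, xbby, t1, t2, t3, t4, t5, t5', t6, t6', t7, t7', t8, t8x, t9, t9x, zero_mul, mul_zero, mul_one, one_mul]
          abel
        rwa [this]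
      have k2 : (1 - e) * ((1 - b * y) * b) = (1 - e) * b := by
        simp only [he, mul_add, add_mul, mul_sub, sub_mul, mul_assoc, cx, cy, r3, r4, r5, r5', r6, r6', r7, r7', r7'', r8, r8x, r9, r9x, abby0, xbby0, abby, xbby, t1, t2, t3, t4, t5, t5', t6, t6', t7, t7', t8, t8x, t9, t9x, zero_mul, mul_zero, mul_one, one_mul]
        abel
      rwa [k2] at k1
    · rw [Commute, SemiconjBy, ← mul_assoc, ← mul_assoc, gag, gbg, h3]
  · have ep : e * (b * y) = b * y := by
      simp only [he, mul_add, add_mul, mul_sub, sub_mul, mul_assoc, cx, cy, r3, r4, r5, r5', r6, r6', r7, r7', r7'', r8, r8x, r9, r9x, abby0, xbby0, abby, xbby, t1, t2, t3, t4, t5, t5', t6, t6', t7, t7', t8, t8x, t9, t9x, zero_mul, mul_zero, mul_one, one_mul]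
      abel
    set s := a + b with hs
    set p := b * y with hp
    have pp : p * p = p := by rw [hp, mul_assoc, t2, r4]
    have cpb : Commute p b := by
      rw [Commute, SemiconjBy, hp, mul_assoc, cy]
    have xp : a * x * p = 0 := by rw [mul_assoc, r6', mul_zero]
    have sp : ∀ k : ℕ, s ^ k * p = p * b ^ k := by
      intro k
      induction k with
      | zero => simp
      | succ k ih =>
        rw [pow_succ', mul_assoc, ih, ← mul_assoc, hs, add_mul, r6, zero_add, ← cpb.eq, mul_assoc,
          ← pow_succ']
    have qbax : (1 - p) * b * (a * x) = 0 := by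
      rw [mul_sub, mul_one] at h2
      exact sub_eq_self.1 h2
    have qe : (1 - p) * e = (1 - p) * (a * x) := by
      have q0 : (1 - p) * p = 0 := by rw [sub_mul, one_mul, pp, sub_self]
      have q1 : (1 - p) * (1 - p) = 1 - p := by rw [mul_sub, q0, mul_one, sub_zero]
      rw [← eE, mul_add, q0, zero_add, ← mul_assoc, q1]
    have qsp : (1 - p) * s * p = 0 := by
      rw [mul_assoc, hs, add_mul, r6, zero_add, ← cpb.eq, ← mul_assoc, sub_mul, one_mul, pp,
        sub_self, zero_mul]
    have cak : ∀ k : ℕ, Commute (a * x) (a ^ k) := fun k =>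
      ((Commute.refl a).pow_right k).mul_left ((show Commute x a from cx).pow_right k)
    have qsk : ∀ k : ℕ, (1 - p) * s ^ k * e = (1 - p) * (a * x) * a ^ k := by
      intro k
      induction k with
      | zero => simpa using qe
      | succ k ih =>
        calc (1 - p) * s ^ (k + 1) * e
            = (1 - p) * s * ((1 - p) * s ^ k * e) + ((1 - p) * s * p) * s ^ k * e := by
              rw [pow_succ']; noncomm_ring
          _ = (1 - p) * s * ((1 - p) * (a * x) * a ^ k) := by rw [ih, qsp]; simp
          _ = (1 - p) * s * ((a * x) * a ^ k) - ((1 - p) * s * p) * (a * x) * a ^ k := by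
              noncomm_ring
          _ = (1 - p) * a * ((a * x) * a ^ k) + ((1 - p) * b * (a * x)) * a ^ k := by
              rw [qsp, hs]; simp [mul_add, add_mul, mul_assoc]
          _ = (1 - p) * (a * x) * a ^ (k + 1) := by
              rw [qbax, zero_mul, add_zero, (cak k).eq, mul_assoc (1 - p), ← mul_assoc a (a ^ k),
                ← pow_succ', ← (cak (k+1)).eq, mul_assoc (1 - p)]
    have up : (s ^ n * e - e) * p = p * (b ^ n - p) := by
      rw [sub_mul, mul_assoc, ep, sp, mul_sub, pp]
    have pup : p * (s ^ n * e - e) * p = p * (b ^ n - p) := by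
      rw [mul_assoc, up, ← mul_assoc, pp]
    refine Qn.tri pp (by rw [up, pup]) ?_ ?_
    · rw [pup]
      exact hyq.mul_left ((cpb.pow_right n).sub_right (Commute.refl p))
    · have : (1 - p) * (s ^ n * e - e) * (1 - p) = (1 - p) * ((a * x) * (a ^ n - a * x)) := by
        have axax : a * x * (a * x) = a * x := by
          rw [mul_assoc, t1, r3]
        have e1 : (1 - p) * (s ^ n * e - e) = (1 - p) * (a ^ n - a * x) * (a * x) := by
          rw [mul_sub, ← mul_assoc, qsk, qe, mul_assoc, (cak n).eq, ← mul_sub, mul_assoc,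
            sub_mul (a ^ n), axax]
        have e2 : a * x * (1 - p) = a * x := by rw [mul_sub, mul_one, xp, sub_zero]
        rw [e1, mul_assoc, e2, mul_assoc]
        congr 1
        rw [mul_sub, sub_mul, (cak n).eq]
      rw [this]
      apply Qn.swap
      have e2 : a * x * (a ^ n - a * x) * (1 - p) = a * x * (a ^ n - a * x) := by
        have e2 : a * x * (1 - p) = a * x := by rw [mul_sub, mul_one, xp, sub_zero]
        rw [(((cak n).sub_right (Commute.refl _))).eq, mul_assoc, e2]
      rw [e2]
      exact hxq.mul_left ((cak n).sub_right (Commute.refl _))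

theorem isGnsDrazinInvertible_add₁ (n : ℕ) (hn : 1 ≤ n) (a b x y : A)
    (hx : (∀ z : A, z * a = a * z → x * z = z * x) ∧ x * a * x = x ∧
      IsQuasinilpotent (a ^ n - a * x))
    (hy : (∀ z : A, z * b = b * z → y * z = z * y) ∧ y * b * y = y ∧
      IsQuasinilpotent (b ^ n - b * y))
    (h1 : a = a * (1 - b * y))
    (h2 : (1 - b * y) * b * (1 - a * x) = (1 - b * y) * b)
    (h3 : (1 - b * y) * (1 - a * x) * b * a = (1 - b * y) * (1 - a * x) * a * b) :
    IsGnsDrazinInvertible n (a + b) := by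
  obtain ⟨hx1, hx2, hx3⟩ := hx
  obtain ⟨hy1, hy2, hy3⟩ := hy
  have hnt : Nontrivial A := by
    by_contra hcon
    rw [not_nontrivial_iff_subsingleton] at hcon
    rw [IsQuasinilpotent, spectrum.of_subsingleton] at hx3
    exact (Set.singleton_ne_empty (0 : ℂ)) hx3.symm
  obtain ⟨z, hz1, hz2, hz3⟩ := main_aux n hn a b x y (hx1 a rfl) hx2 hx3.qn (hy1 b rfl) hy2 hy3.qn
    h1 h2 h3
  exact ⟨z, fun t ht => bicomm (a + b) z hz1 hz2 hz3 t ht, hz2, hz3.isQuasinilpotent⟩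
end
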